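/- Let n ≥ 1, let 1 ≤ p < q < ∞ and define r by n/r = 1/p − 1/q. Let E be a Köthe sequence space containing ℓ_p, and set G = ℓ_n(𝓛;ℓ_r,E). Let X_1,…,X_n, Y be Banach spaces and let T : X_1 × ⋯ × X_n → Y be a bounded n-linear map satisfying the strongly (E,p)-summing inequality with constant C. Then T satisfies the strongly (G,q)-summing inequality with constant C. (Inclusion theorem: every strongly (E,p)-summing n-linear operator is strongly (ℓ_n(𝓛;ℓ_r,E),q)-summing.) -/

import Mathlib

/-- A Köthe sequence space: a linear subspace of `ℂ^ℕ` with a complete norm such that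
`ℓ₁ ⊆ E ⊆ ℓ_∞` with inclusions of norm at most 1, and which is normal. -/
structure KotheSpace : Type where
  Mem : (ℕ → ℂ) → Prop
  nrm : (ℕ → ℂ) → ℝ
  mem_zero : Mem 0
  mem_add : ∀ {x y : ℕ → ℂ}, Mem x → Mem y → Mem (x + y)
  mem_smul : ∀ (c : ℂ) {x : ℕ → ℂ}, Mem x → Mem (c • x)
  nrm_add_le : ∀ {x y : ℕ → ℂ}, Mem x → Mem y → nrm (x + y) ≤ nrm x + nrm y
  nrm_smul : ∀ (c : ℂ) {x : ℕ → ℂ}, Mem x → nrm (c • x) = ‖c‖ * nrm x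
  nrm_eq_zero_iff : ∀ {x : ℕ → ℂ}, Mem x → (nrm x = 0 ↔ x = 0)
  l1_mem : ∀ {x : ℕ → ℂ}, Summable (fun k => ‖x k‖) → Mem x
  nrm_le_l1 : ∀ {x : ℕ → ℂ}, Summable (fun k => ‖x k‖) → nrm x ≤ ∑' k, ‖x k‖
  coord_le_nrm : ∀ {x : ℕ → ℂ}, Mem x → ∀ k, ‖x k‖ ≤ nrm x
  normal_mem : ∀ {x y : ℕ → ℂ}, Mem y → (∀ k, ‖x k‖ ≤ ‖y k‖) → Mem x
  normal_nrm : ∀ {x y : ℕ → ℂ}, Mem x → Mem y → (∀ k, ‖x k‖ ≤ ‖y k‖) → nrm x ≤ nrm y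
  complete : ∀ f : ℕ → ℕ → ℂ, (∀ i, Mem (f i)) →
    (∀ ε : ℝ, 0 < ε → ∃ N, ∀ i, N ≤ i → ∀ j, N ≤ j → nrm (f i - f j) < ε) →
    ∃ g, Mem g ∧ ∀ ε : ℝ, 0 < ε → ∃ N, ∀ i, N ≤ i → nrm (f i - g) < ε

namespace KotheSpace

/-- Membership in the Köthe dual `E^×`. -/
def dualMem (E : KotheSpace) (z : ℕ → ℂ) : Prop :=
  ∀ x, E.Mem x → Summable fun k => ‖z k * x k‖

/-- The norm of the Köthe dual `E^×`. -/
noncomputable def dualNrm (E : KotheSpace) (z : ℕ → ℂ) : ℝ :=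
  sSup {r | ∃ x, E.Mem x ∧ E.nrm x ≤ 1 ∧ r = ∑' k, ‖z k * x k‖}

/-- Membership in the Köthe bidual `E^××`. -/
def bidualMem (E : KotheSpace) (z : ℕ → ℂ) : Prop :=
  ∀ w, E.dualMem w → Summable fun k => ‖z k * w k‖

/-- The norm of the Köthe bidual `E^××`. -/
noncomputable def bidualNrm (E : KotheSpace) (z : ℕ → ℂ) : ℝ :=
  sSup {r | ∃ w, E.dualMem w ∧ E.dualNrm w ≤ 1 ∧ r = ∑' k, ‖z k * w k‖}

end KotheSpace

/-- Membership in the Köthe sequence space `ℓ_n(𝓛; ℓ_r, E)` of diagonal bounded `n`-linear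
operators from `ℓ_r` into `E`: bounded sequences `α` with `α·z_1⋯z_n ∈ E` for all
`z_1,…,z_n ∈ ℓ_r`. -/
def lnLMem (n : ℕ) (r : ℝ) (E : KotheSpace) (α : ℕ → ℂ) : Prop :=
  (∃ M : ℝ, ∀ k, ‖α k‖ ≤ M) ∧
  ∀ z : Fin n → ℕ → ℂ, (∀ i, Summable fun k => ‖z i k‖ ^ r) →
    E.Mem fun k => α k * ∏ i, z i k

/-- The norm of `ℓ_n(𝓛; ℓ_r, E)`:
`‖α‖ = sup{‖α·z_1⋯z_n‖_E : ‖z_j‖_{ℓ_r} ≤ 1}`. -/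
noncomputable def lnLNrm (n : ℕ) (r : ℝ) (E : KotheSpace) (α : ℕ → ℂ) : ℝ :=
  sSup {s | ∃ z : Fin n → ℕ → ℂ,
    (∀ i, Summable (fun k => ‖z i k‖ ^ r) ∧ (∑' k, ‖z i k‖ ^ r) ^ (1 / r) ≤ 1) ∧
    s = E.nrm fun k => α k * ∏ i, z i k}

open scoped BigOperators

/-- A bounded `n`-linear map `T` satisfies the strongly `(H,s)`-summing inequality with
constant `C`: for all finite families the finitely supported sequence
`i ↦ ‖T(x_{1,i},…,x_{n,i})‖` belongs to `H` with `H`-norm at most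
`C · sup{(∑_i |φ(x_{1,i},…,x_{n,i})|^s)^{1/s} : ‖φ‖ ≤ 1}`, the supremum running over
bounded `n`-linear forms `φ` of norm at most 1. -/
def StronglySummingIneq (HMem : (ℕ → ℂ) → Prop) (Hnrm : (ℕ → ℂ) → ℝ) (s : ℝ) {n : ℕ}
    {X : Fin n → Type*} [∀ j, NormedAddCommGroup (X j)] [∀ j, NormedSpace ℂ (X j)]
    {Y : Type*} [NormedAddCommGroup Y] [NormedSpace ℂ Y]
    (T : ContinuousMultilinearMap ℂ X Y) (C : ℝ) : Prop :=
  ∀ (m : ℕ) (x : ∀ j, Fin m → X j),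
    HMem (fun i => if h : i < m then Complex.ofReal ‖T (fun j => x j ⟨i, h⟩)‖ else 0) ∧
    Hnrm (fun i => if h : i < m then Complex.ofReal ‖T (fun j => x j ⟨i, h⟩)‖ else 0) ≤
      C * sSup {t | ∃ φ : ContinuousMultilinearMap ℂ X ℂ, ‖φ‖ ≤ 1 ∧
        t = (∑ i, ‖φ (fun j => x j i)‖ ^ s) ^ (1 / s)}

open Finset in
/-- If each of `n` families of nonnegative reals has `r`-th powers summing to at most `1`, then so
do the `r / n`-th powers of their pointwise product. -/
theorem sum_prod_rpow_div_card_le_one {ι : Type*} {n : ℕ} (hn : 1 ≤ n) (s : Finset ι) {r : ℝ}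
    {w : Fin n → ι → ℝ} (hw : ∀ j i, 0 ≤ w j i) (h : ∀ j, ∑ i ∈ s, w j i ^ r ≤ 1) :
    ∑ i ∈ s, (∏ j, w j i) ^ (r / n) ≤ 1 := by
  have hn0 : (n : ℝ) ≠ 0 := by positivity
  calc ∑ i ∈ s, (∏ j, w j i) ^ (r / n)
      ≤ ∑ i ∈ s, ∑ j, (n : ℝ)⁻¹ * w j i ^ r := by
        gcongr with i
        have := Real.geom_mean_le_arith_mean_weighted univ (fun _ : Fin n => (n : ℝ)⁻¹)
          (fun j => w j i ^ r) (fun _ _ => by positivity) (by simp [hn0])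
          (fun j _ => Real.rpow_nonneg (hw j i) r)
        rw [← Real.finsetProd_rpow _ _ fun j _ => hw j i]
        simpa only [← Real.rpow_mul (hw _ i), ← div_eq_mul_inv] using this
    _ = ∑ j, (n : ℝ)⁻¹ * ∑ i ∈ s, w j i ^ r := by
        rw [sum_comm]
        simp only [mul_sum]
    _ ≤ ∑ _j : Fin n, (n : ℝ)⁻¹ * 1 := by
        gcongr with j
        exact h j
    _ = 1 := by simp [hn0]

open Finset in
/-- Hölder's inequality for a family and a weight in the unit ball of `ℓ_t`. -/
theorem Lr_mul_le_Lp_of_sum_rpow_le_one {ι : Type*} (s : Finset ι) {a w : ι → ℝ} {p q t : ℝ}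
    (hqtp : q.HolderTriple t p) (ha : ∀ i, 0 ≤ a i) (hw : ∀ i, 0 ≤ w i)
    (h : ∑ i ∈ s, w i ^ t ≤ 1) :
    (∑ i ∈ s, (w i * a i) ^ p) ^ (1 / p) ≤ (∑ i ∈ s, a i ^ q) ^ (1 / q) := by
  have hp : 0 < p := hqtp.pos'
  have hq : 0 < q := hqtp.pos
  have ht : 0 < t := hqtp.symm.pos
  have hA : 0 ≤ ∑ i ∈ s, a i ^ q := sum_nonneg fun i _ => Real.rpow_nonneg (ha i) q
  have hW : 0 ≤ ∑ i ∈ s, w i ^ t := sum_nonneg fun i _ => Real.rpow_nonneg (hw i) t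
  have hsum : ∑ i ∈ s, (w i * a i) ^ p ≤ (∑ i ∈ s, a i ^ q) ^ (p / q) :=
    calc ∑ i ∈ s, (w i * a i) ^ p
        = ∑ i ∈ s, (a i * w i) ^ p := by simp only [mul_comm]
      _ ≤ (∑ i ∈ s, a i ^ q) ^ (p / q) * (∑ i ∈ s, w i ^ t) ^ (p / t) :=
          Real.Lr_rpow_le_Lp_mul_Lq_of_nonneg s hqtp (fun i _ => ha i) fun i _ => hw i
      _ ≤ (∑ i ∈ s, a i ^ q) ^ (p / q) :=
          mul_le_of_le_one_right (Real.rpow_nonneg hA _)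
            (Real.rpow_le_one hW h (by positivity))
  calc (∑ i ∈ s, (w i * a i) ^ p) ^ (1 / p)
      ≤ ((∑ i ∈ s, a i ^ q) ^ (p / q)) ^ (1 / p) :=
        Real.rpow_le_rpow
          (sum_nonneg fun i _ => Real.rpow_nonneg (mul_nonneg (hw i) (ha i)) p) hsum
          (by positivity)
    _ = (∑ i ∈ s, a i ^ q) ^ (1 / q) := by
        rw [← Real.rpow_mul hA]
        congr 1
        field_simp

section WeakNorm

variable {n : ℕ} {X : Fin n → Type*} [∀ j, NormedAddCommGroup (X j)] [∀ j, NormedSpace ℂ (X j)]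
  {m : ℕ}

/-- The values over which the supremum on the right-hand side of the strongly summing inequality
is taken are bounded. -/
theorem bddAbove_form_lp_norms (x : ∀ j, Fin m → X j) {s : ℝ} (hs : 0 < s) :
    BddAbove {t | ∃ φ : ContinuousMultilinearMap ℂ X ℂ, ‖φ‖ ≤ 1 ∧
      t = (∑ i, ‖φ (fun j => x j i)‖ ^ s) ^ (1 / s)} := by
  refine ⟨(∑ i, (∏ j, ‖x j i‖) ^ s) ^ (1 / s), ?_⟩
  rintro _ ⟨φ, hφ, rfl⟩
  gcongr with i
  exact φ.le_of_opNorm_le hφ _ |>.trans_eq (one_mul _)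

/-- Scaling the vectors by families in the unit ball of `ℓ_r` lowers the exponent of the
supremum over forms from `q` to `p`. -/
theorem sSup_form_lp_norms_smul_le (hn : 1 ≤ n) {p q r : ℝ} (hqrp : q.HolderTriple (r / n) p)
    (x : ∀ j, Fin m → X j) (z : Fin n → Fin m → ℂ) (hz : ∀ j, ∑ i, ‖z j i‖ ^ r ≤ 1) :
    sSup {t | ∃ φ : ContinuousMultilinearMap ℂ X ℂ, ‖φ‖ ≤ 1 ∧
        t = (∑ i, ‖φ (fun j => z j i • x j i)‖ ^ p) ^ (1 / p)} ≤
      sSup {t | ∃ φ : ContinuousMultilinearMap ℂ X ℂ, ‖φ‖ ≤ 1 ∧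
        t = (∑ i, ‖φ (fun j => x j i)‖ ^ q) ^ (1 / q)} := by
  refine csSup_le ⟨_, 0, by simp, rfl⟩ ?_
  rintro _ ⟨φ, hφ, rfl⟩
  refine le_csSup_of_le (bddAbove_form_lp_norms x hqrp.pos) ⟨φ, hφ, rfl⟩ ?_
  simp only [φ.map_smul_univ, norm_smul, norm_prod]
  exact Lr_mul_le_Lp_of_sum_rpow_le_one _ hqrp (fun _ => norm_nonneg _)
    (fun _ => Finset.prod_nonneg fun _ _ => norm_nonneg _)
    (sum_prod_rpow_div_card_le_one hn _ (fun _ _ => norm_nonneg _) hz)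

end WeakNorm

/-- A Köthe sequence space contains all finitely supported sequences. -/
theorem KotheSpace.mem_of_forall_ge_eq_zero (E : KotheSpace) {x : ℕ → ℂ} (m : ℕ)
    (hx : ∀ k, m ≤ k → x k = 0) : E.Mem x :=
  E.l1_mem <| summable_of_ne_finset_zero (s := Finset.range m) fun k hk => by
    simp [hx k (by simpa using hk)]

/-- `ℓ_n(𝓛; ℓ_r, E)` contains all finitely supported sequences. -/
theorem lnLMem_of_forall_ge_eq_zero (n : ℕ) (r : ℝ) (E : KotheSpace) {x : ℕ → ℂ} (m : ℕ)
    (hx : ∀ k, m ≤ k → x k = 0) : lnLMem n r E x :=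
  ⟨⟨_, E.coord_le_nrm (E.mem_of_forall_ge_eq_zero m hx)⟩, fun _ _ =>
    E.mem_of_forall_ge_eq_zero m fun k hk => by simp [hx k hk]⟩

/-- The first `m` terms of a sequence in the unit ball of `ℓ_r` have `r`-th powers summing to at
most `1`. -/
theorem sum_fin_norm_rpow_le_one {r : ℝ} (hr : 0 < r) {z : ℕ → ℂ}
    (hz : Summable fun k => ‖z k‖ ^ r) (hz1 : (∑' k, ‖z k‖ ^ r) ^ (1 / r) ≤ 1) (m : ℕ) :
    ∑ i : Fin m, ‖z i‖ ^ r ≤ 1 := by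
  have h0 : 0 ≤ ∑' k, ‖z k‖ ^ r := tsum_nonneg fun k => by positivity
  rw [Fin.sum_univ_eq_sum_range (fun k => ‖z k‖ ^ r) m]
  refine (hz.sum_le_tsum _ fun k _ => by positivity).trans ?_
  by_contra! h
  exact hz1.not_gt (Real.one_lt_rpow h (by positivity))

/-- Inclusion theorem for strongly `(E,p)`-summing multilinear operators: for
`1 ≤ p < q` and `n/r = 1/p - 1/q`, with `ℓ_p ⊆ E`, every strongly `(E,p)`-summing
`n`-linear operator (with constant `C`) is strongly `(ℓ_n(𝓛;ℓ_r,E), q)`-summing (with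
the same constant `C`). -/
theorem strongly_summing_inclusion (n : ℕ) (hn : 1 ≤ n) (p q r : ℝ) (hp : 1 ≤ p)
    (hpq : p < q) (hr : (n : ℝ) / r = 1 / p - 1 / q) (E : KotheSpace)
    (hE : ∀ x : ℕ → ℂ, Summable (fun k => ‖x k‖ ^ p) → E.Mem x)
    {X : Fin n → Type*} [∀ j, NormedAddCommGroup (X j)] [∀ j, NormedSpace ℂ (X j)]
    {Y : Type*} [NormedAddCommGroup Y] [NormedSpace ℂ Y]
    (T : ContinuousMultilinearMap ℂ X Y) (C : ℝ) (hC : 0 ≤ C)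
    (hT : StronglySummingIneq E.Mem E.nrm p T C) :
    StronglySummingIneq (lnLMem n r E) (lnLNrm n r E) q T C := by
  have hn0 : (0 : ℝ) < n := by exact_mod_cast hn
  have hp0 : 0 < p := by linarith
  have hq0 : 0 < q := hp0.trans hpq
  have hr0 : 0 < r := by
    have h : 0 < (n : ℝ) / r := by
      rw [hr, sub_pos]
      exact one_div_lt_one_div_of_lt hp0 hpq
    exact (div_pos_iff_of_pos_left hn0).1 h
  have hqrp : q.HolderTriple (r / n) p :=
    { inv_add_inv_eq_inv := by
        rw [inv_div, hr]
        simp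
      left_pos := hq0
      right_pos := by positivity }
  intro m x
  refine ⟨lnLMem_of_forall_ge_eq_zero n r E m fun k hk => dif_neg hk.not_gt, ?_⟩
  refine csSup_le ⟨_, 0, fun _ => ?_, rfl⟩ ?_
  · simp [Real.zero_rpow hr0.ne', Real.zero_rpow (inv_pos.2 hr0).ne', summable_zero]
  rintro _ ⟨z, hz, rfl⟩
  obtain ⟨hmem, hle⟩ := hT m fun j i => z j i • x j i
  refine (E.normal_nrm (E.mem_of_forall_ge_eq_zero m fun k hk => ?_) hmem fun k => ?_).trans
    (hle.trans (mul_le_mul_of_nonneg_left ?_ hC))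
  · simp [hk.not_gt]
  · by_cases hk : k < m
    · simp [hk, T.map_smul_univ, norm_smul, mul_comm]
    · simp [hk]
  · exact sSup_form_lp_norms_smul_le hn hqrp x (fun j i => z j i) fun j =>
      sum_fin_norm_rpow_le_one hr0 (hz j).1 (hz j).2 m
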